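/- Let k ≥ 2, n_leaf ≥ 1, n ≥ 1, and C ≥ 0 be given (C a nonnegative real, the per-instance cost). Let T be a finite rooted tree of depth D with instance counts n : nodes(T) → ℕ such that the root has count n, the counts of the children of any internal node sum to the count of that node, and k^D · n_leaf ≤ n. If the cost of each node v is at most n_v · C, then the total cost Σ_v n_v · C over all nodes of T is at most (Real.logb k (n / n_leaf) + 1) · n · C. -/

import Mathlib

/-- A finite rooted tree in which every node `v` carries the number `n_v` of
training instances associated with it. -/
inductive ITree : Type where
  | node : ℕ → List ITree → ITree

/-- The instance count `n_v` at the root of the tree. -/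
def ITree.count : ITree → ℕ
  | .node n _ => n

/-- The sum of the instance counts `n_v` over all nodes of the tree. -/
def ITree.total : ITree → ℕ
  | .node n cs => n + (cs.attach.map (fun c => c.1.total)).sum
decreasing_by
  have := List.sizeOf_lt_of_mem c.2
  simp only [ITree.node.sizeOf_spec]
  omega

/-- The depth of the tree: the maximum number of edges on a root-to-leaf path. -/
def ITree.depth : ITree → ℕ
  | .node _ [] => 0
  | .node _ (c :: cs) => 1 + (((c :: cs).attach.map (fun t => t.1.depth)).foldr max 0)
decreasing_by
  have := List.sizeOf_lt_of_mem t.2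
  simp only [ITree.node.sizeOf_spec]
  omega

/-- The instances of every internal node are partitioned among its children:
the counts assigned to the children of each internal (non-leaf) node sum to the
count of that node. -/
inductive ITree.WellSplit : ITree → Prop
  | node (n : ℕ) (cs : List ITree)
      (hsum : cs ≠ [] → (cs.map ITree.count).sum = n)
      (hrec : ∀ c ∈ cs, ITree.WellSplit c) :
      ITree.WellSplit (.node n cs)

theorem ITree.depth_lt_of_mem {n : ℕ} {cs : List ITree} {c : ITree} (hc : c ∈ cs) :
    c.depth < (ITree.node n cs).depth := by
  have le_foldr_max : ∀ (l : List ℕ) (a : ℕ), a ∈ l → a ≤ l.foldr max 0 := by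
    intro l
    induction l with
    | nil => simp
    | cons b l ih =>
      intro a ha
      rcases List.mem_cons.mp ha with rfl | ha
      · exact le_max_left _ _
      · exact (ih a ha).trans (le_max_right _ _)
  cases cs with
  | nil => simp at hc
  | cons d ds =>
    rw [ITree.depth]
    have := le_foldr_max ((d :: ds).attach.map fun t => t.1.depth) c.depth
      (List.mem_map.mpr ⟨⟨c, hc⟩, List.mem_attach _ _, rfl⟩)
    omega

/-- Each level of a well-split tree carries at most the instances of the root. -/
theorem ITree.WellSplit.total_le {T : ITree} (h : T.WellSplit) :
    T.total ≤ (T.depth + 1) * T.count := by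
  induction h with
  | node n cs hsum _ ih =>
    rw [ITree.total, ITree.count, List.attach_map_val (f := ITree.total)]
    rcases eq_or_ne cs [] with rfl | hne
    · simp [ITree.depth]
    · have hle : (cs.map ITree.total).sum ≤
          (cs.map fun c => (ITree.node n cs).depth * c.count).sum :=
        List.sum_le_sum fun c hc =>
          (ih c hc).trans (Nat.mul_le_mul_right _ (ITree.depth_lt_of_mem hc))
      rw [List.sum_map_mul_left, hsum hne] at hle
      linarith

/-- Proposition 1 of the paper (balanced case): for a tree of depth `D` with root
instance count `n`, whose children counts sum to the parent count, and with
`k^D * n_leaf ≤ n` (where `k ≥ 2`, `n_leaf ≥ 1`, `n ≥ 1`), if each node costs at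
most `n_v * C` (with `C ≥ 0` the per-instance cost), then the total cost
`Σ_v n_v * C` is at most `(log_k (n / n_leaf) + 1) * n * C`. -/
theorem balanced_training_cost_bound
    (k n_leaf n : ℕ) (C : ℝ)
    (hk : 2 ≤ k) (hleaf : 1 ≤ n_leaf) (hn : 1 ≤ n) (hC : 0 ≤ C)
    (T : ITree) (hws : T.WellSplit) (hroot : T.count = n)
    (hdepth : k ^ T.depth * n_leaf ≤ n)
    (cost : ITree → ℝ) (hcost : ∀ v : ITree, cost v ≤ (v.count : ℝ) * C) :
    (T.total : ℝ) * C ≤ (Real.logb k ((n : ℝ) / (n_leaf : ℝ)) + 1) * n * C := by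
  have htotal : (T.total : ℝ) ≤ (T.depth + 1) * n := by
    have := hws.total_le
    rw [hroot] at this
    exact_mod_cast this
  have hk' : (1 : ℝ) < k := by exact_mod_cast hk
  have hleaf' : (0 : ℝ) < n_leaf := by exact_mod_cast hleaf
  have hn' : (0 : ℝ) < n := by exact_mod_cast hn
  have hlog : (T.depth : ℝ) ≤ Real.logb k ((n : ℝ) / n_leaf) := by
    rw [Real.le_logb_iff_rpow_le hk' (by positivity), Real.rpow_natCast, le_div_iff₀ hleaf']
    exact_mod_cast hdepth
  refine mul_le_mul_of_nonneg_right (htotal.trans ?_) hC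
  gcongr
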